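/- arXiv:2211.17227 — 3 statements merged into one kernel-verified Lean document; each statement's English description precedes it below -/
import Mathlib

section
/- Let φ : R → R' be a faithfully flat homomorphism of commutative rings and let M be a cochain complex of R-modules. Then M has bounded finitely generated cohomology over R (i.e., H^i(M) is a finitely generated R-module for every i, and H^i(M) = 0 for all but finitely many i) if and only if the base-changed complex M ⊗_R R', obtained by applying the extension-of-scalars functor (−) ⊗_R R' termwise to M, has bounded finitely generated cohomology over R'. -/
open CategoryTheory

universe u

/-- A cochain complex of `S`-modules has *bounded finitely generated cohomology* if each
cohomology module `H^i(M)` is a finitely generated `S`-module and `H^i(M) = 0` for all but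
finitely many `i`. -/
def HasBoundedFGCohomology (S : Type u) [CommRing S]
    (M : CochainComplex (ModuleCat.{u} S) ℤ) : Prop :=
  (∀ i : ℤ, Module.Finite S (M.homology i)) ∧
    {i : ℤ | ¬ Subsingleton (M.homology i)}.Finite

instance extendScalarsAdditive {R R' : Type u} [CommRing R] [CommRing R'] (φ : R →+* R') :
    (ModuleCat.extendScalars φ).Additive := by
  constructor
  intro X Y f g
  show ModuleCat.ExtendScalars.map' φ (f + g) =
    ModuleCat.ExtendScalars.map' φ f + ModuleCat.ExtendScalars.map' φ g
  letI : Algebra R R' := ((algebraMap R' R').comp φ).toAlgebra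
  exact ModuleCat.hom_ext (LinearMap.baseChange_add f.hom g.hom)

namespace ModuleCat

variable {R R' : Type u} [CommRing R] [CommRing R'] (φ : R →+* R')

lemma preservesHomology_extendScalars_of_flat (hφ : φ.Flat) :
    (extendScalars.{u, u, u} φ).PreservesHomology := by
  have := preservesFiniteLimits_extendScalars_of_flat hφ
  have : Limits.PreservesColimitsOfSize.{0, 0} (extendScalars.{u, u, u} φ) :=
    (extendRestrictScalarsAdj.{u, u, u} φ).leftAdjoint_preservesColimits
  exact { }

/-- Extension of scalars along a flat ring homomorphism commutes with homology. -/
noncomputable def homologyExtendScalarsIso (hφ : φ.Flat) {ι : Type*} {c : ComplexShape ι}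
    (M : HomologicalComplex (ModuleCat.{u} R) c) (i : ι) :
    (((extendScalars φ).mapHomologicalComplex c).obj M).homology i ≅
      (extendScalars φ).obj (M.homology i) :=
  haveI := preservesHomology_extendScalars_of_flat φ hφ
  (M.sc i).mapHomologyIso (extendScalars φ)

lemma finite_extendScalars_obj_iff (hφ : φ.FaithfullyFlat) (N : ModuleCat.{u} R) :
    Module.Finite R' ((extendScalars φ).obj N) ↔ Module.Finite R N := by
  let := φ.toAlgebra
  have : Module.FaithfullyFlat R R' := hφ
  change Module.Finite R' (TensorProduct R R' N) ↔ _
  exact ⟨fun _ ↦ .of_finite_tensorProduct_of_faithfullyFlat R', fun _ ↦ inferInstance⟩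

lemma subsingleton_extendScalars_obj_iff (hφ : φ.FaithfullyFlat) (N : ModuleCat.{u} R) :
    Subsingleton ((extendScalars φ).obj N) ↔ Subsingleton N := by
  let := φ.toAlgebra
  have : Module.FaithfullyFlat R R' := hφ
  exact Module.FaithfullyFlat.subsingleton_tensorProduct_iff_right R R'

end ModuleCat

/-- Let `φ : R → R'` be a faithfully flat homomorphism of commutative rings and `M` a
cochain complex of `R`-modules.  Then `M` has bounded finitely generated cohomology over
`R` if and only if the termwise base change `M ⊗_R R'` (obtained by applying the
extension-of-scalars functor along `φ` termwise) has bounded finitely generated cohomology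
over `R'`. -/
theorem hasBoundedFGCohomology_iff_of_faithfullyFlat
    {R R' : Type u} [CommRing R] [CommRing R'] (φ : R →+* R')
    (hff : letI := φ.toAlgebra; Module.FaithfullyFlat R R')
    (M : CochainComplex (ModuleCat.{u} R) ℤ) :
    HasBoundedFGCohomology R M ↔
      HasBoundedFGCohomology R'
        (((ModuleCat.extendScalars φ).mapHomologicalComplex (ComplexShape.up ℤ)).obj M) := by
  have hφ : φ.FaithfullyFlat := hff
  have e (i : ℤ) := (ModuleCat.homologyExtendScalarsIso φ hφ.flat M i).toLinearEquiv
  simp only [HasBoundedFGCohomology, Module.Finite.equiv_iff (e _),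
    (e _).toEquiv.subsingleton_congr,
    ModuleCat.finite_extendScalars_obj_iff φ hφ, ModuleCat.subsingleton_extendScalars_obj_iff φ hφ]
end

section
/- Let k be a field and let M be a module over the power series ring k[[u]] such that for every n ≥ 1 the multiplication-by-u map M[u^{n+1}] → M[u^n] is surjective, and such that d := dim_k M[u] is finite. Then the u-adic Tate module T_u(M), regarded as a k[[u]]-submodule of ∏_{n ≥ 1} M[u^n] with the componentwise action, is a free k[[u]]-module of rank d. -/
open PowerSeries

/-- The `x`-adic Tate module of an `R`-module `M`, realized as the `R`-submodule of
`∏_{n ≥ 1} M[x^n]` (reindexed so that the `n`-th component is `y_{n+1} ∈ M[x^{n+1}]`)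
consisting of the sequences `(y_n)_{n ≥ 1}` with `x^n • y_n = 0` and `x • y_{n+1} = y_n`
for all `n ≥ 1`, with the componentwise `R`-action. -/
def tateModule (R : Type*) [CommRing R] (x : R)
    (M : Type*) [AddCommGroup M] [Module R M] : Submodule R (ℕ → M) where
  carrier := {y | ∀ n : ℕ, x ^ (n + 1) • y n = 0 ∧ x • y (n + 1) = y n}
  zero_mem' := by intro n; simp
  add_mem' := by
    intro a b ha hb n
    refine ⟨?_, ?_⟩ <;> simp [smul_add, (ha n).1, (hb n).1, (ha n).2, (hb n).2]
  smul_mem' := by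
    intro c y hy n
    constructor
    · rw [Pi.smul_apply, smul_comm, (hy n).1, smul_zero]
    · rw [Pi.smul_apply, Pi.smul_apply, smul_comm, (hy n).2]

namespace tateModule

variable {R : Type*} [CommRing R] {x : R} {M : Type*} [AddCommGroup M] [Module R M]

theorem smul_apply_zero (y : tateModule R x M) : x • y.1 0 = 0 := by
  simpa using (y.2 0).1

theorem smul_apply_succ (y : tateModule R x M) (n : ℕ) : x • y.1 (n + 1) = y.1 n :=
  (y.2 n).2

/-- Multiplication by `x` is injective on the Tate module. -/
theorem eq_zero_of_smul_eq_zero {y : tateModule R x M} (h : x • y = 0) : y = 0 := by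
  ext n
  rw [← smul_apply_succ y n]
  exact congrFun (congrArg Subtype.val h) (n + 1)

theorem pow_smul_apply (y : tateModule R x M) (n : ℕ) : x ^ n • y.1 n = y.1 0 := by
  induction n with
  | zero => simp
  | succ n ih => rw [pow_succ, mul_smul, smul_apply_succ, ih]

/-- An element of the Tate module whose first component vanishes is divisible by `x`. -/
theorem exists_smul_eq {y : tateModule R x M} (h : y.1 0 = 0) :
    ∃ z : tateModule R x M, x • z = y := by
  refine ⟨⟨fun n => y.1 (n + 1), fun n => ⟨?_, smul_apply_succ y (n + 1)⟩⟩, ?_⟩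
  · rw [pow_smul_apply y (n + 1), h]
  · ext n
    exact smul_apply_succ y n

/-- The Tate module is `x`-adically separated, in the form needed for successive
approximation. -/
theorem eq_zero_of_forall_eq_smul {D : ℕ → tateModule R x M}
    (h : ∀ j, D j = x • D (j + 1)) (j : ℕ) : D j = 0 := by
  ext n
  change (D j).1 n = 0
  induction n generalizing j with
  | zero =>
    rw [h j]
    exact smul_apply_zero (D (j + 1))
  | succ n ih =>
    rw [h j]
    exact (smul_apply_succ (D (j + 1)) n).trans (ih (j + 1))

/-- If the maps `M[x^{n+1}] → M[x^n]` are surjective, every element of `M[x]` is the first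
component of an element of the Tate module. -/
theorem exists_apply_zero_eq
    (hsurj : ∀ n : ℕ, 1 ≤ n → ∀ m ∈ Submodule.torsionBy R M (x ^ n),
      ∃ m' ∈ Submodule.torsionBy R M (x ^ (n + 1)), x • m' = m)
    {m : M} (hm : x • m = 0) : ∃ y : tateModule R x M, y.1 0 = m := by
  choose! f hf hfx using hsurj
  let y : ℕ → M := fun n => Nat.rec m (fun i z => f (i + 1) z) n
  have hy : ∀ n, y n ∈ Submodule.torsionBy R M (x ^ (n + 1)) := by
    intro n
    induction n with
    | zero => simpa [y] using hm
    | succ n ih => exact hf (n + 1) (by omega) _ ih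
  exact ⟨⟨y, fun n => ⟨(Submodule.mem_torsionBy_iff _ _).1 (hy n),
    hfx (n + 1) (by omega) _ (hy n)⟩⟩, rfl⟩

end tateModule

/-- A power series acts on elements killed by `X` through its constant coefficient. -/
theorem PowerSeries.smul_eq_constantCoeff_smul {k M : Type*} [Field k] [AddCommGroup M]
    [Module (PowerSeries k) M] [Module k M] [IsScalarTower k (PowerSeries k) M]
    (f : PowerSeries k) {m : M} (hm : (X : PowerSeries k) • m = 0) :
    f • m = constantCoeff f • m := by
  conv_lhs => rw [eq_shift_mul_X_add_const f]
  rw [add_smul, mul_smul, hm, smul_zero, zero_add]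
  exact algebraMap_smul (PowerSeries k) (constantCoeff f) m

/-- Elements of the Tate module over `k[[X]]` whose first components form a `k`-basis of
`M[X]` induce a bijection from the free module. -/
theorem tateModule.bijective_linearCombination {k M ι : Type*} [Field k] [Fintype ι]
    [AddCommGroup M] [Module (PowerSeries k) M] [Module k M]
    [IsScalarTower k (PowerSeries k) M]
    (b : Module.Basis ι k
      ((Submodule.torsionBy (PowerSeries k) M (X : PowerSeries k)).restrictScalars k))
    (t : ι → tateModule (PowerSeries k) (X : PowerSeries k) M)
    (ht : ∀ i, (t i).1 0 = (b i : M)) :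
    Function.Bijective (Fintype.linearCombination (PowerSeries k) t) := by
  set Φ := Fintype.linearCombination (PowerSeries k) t with hΦ
  have hΦ_zero (c : ι → PowerSeries k) :
      (Φ c).1 0 = ((∑ i, constantCoeff (c i) • b i :
        (Submodule.torsionBy (PowerSeries k) M (X : PowerSeries k)).restrictScalars k) : M) := by
    rw [hΦ, Fintype.linearCombination_apply]
    simp only [Submodule.coe_sum, Finset.sum_apply, Submodule.coe_smul, Pi.smul_apply, ht]
    refine Finset.sum_congr rfl fun i _ => smul_eq_constantCoeff_smul _ ?_
    exact (Submodule.mem_torsionBy_iff _ _).1 (b i).2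
  constructor
  · rw [injective_iff_map_eq_zero]
    have key (N : ℕ) : ∀ c, Φ c = 0 → ∀ i, coeff N (c i) = 0 := by
      induction N with
      | zero =>
        intro c hc i
        have h0 := hΦ_zero c
        rw [hc] at h0
        simpa using Fintype.linearIndependent_iff.1 b.linearIndependent _
          (Subtype.ext h0.symm) i
      | succ N ih =>
        intro c hc i
        have h0 := hΦ_zero c
        rw [hc] at h0
        have hc0 := Fintype.linearIndependent_iff.1 b.linearIndependent _
          (Subtype.ext h0.symm)
        choose c' hc' using fun i => X_dvd_iff.2 (hc0 i)
        obtain rfl : c = (X : PowerSeries k) • c' := funext hc'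
        rw [map_smul] at hc
        simpa [coeff_succ_X_mul] using ih c' (eq_zero_of_smul_eq_zero hc) i
    intro c hc
    ext i N
    exact key N c hc i
  · intro y
    have step (y : tateModule (PowerSeries k) (X : PowerSeries k) M) :
        ∃ (a : ι → k) (z : tateModule (PowerSeries k) (X : PowerSeries k) M),
          (X : PowerSeries k) • z = y - Φ fun i => C (a i) := by
      let m : (Submodule.torsionBy (PowerSeries k) M
          (X : PowerSeries k)).restrictScalars k :=
        ⟨y.1 0, (Submodule.mem_torsionBy_iff _ _).2 (smul_apply_zero y)⟩
      refine ⟨b.repr m, exists_smul_eq ?_⟩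
      change y.1 0 - (Φ _).1 0 = 0
      rw [hΦ_zero]
      simp only [constantCoeff_C, b.sum_repr, m, sub_self]
    choose a z hz using step
    let Y : ℕ → tateModule (PowerSeries k) (X : PowerSeries k) M := fun j => z^[j] y
    let c : ℕ → ι → PowerSeries k := fun j i => mk fun l => a (Y (j + l)) i
    have hc (j : ℕ) : c j = (fun i => C (a (Y j) i)) + (X : PowerSeries k) • c (j + 1) := by
      ext i l
      cases l with
      | zero => simp [c]
      | succ l => simp [c, coeff_succ_X_mul, add_assoc, add_comm 1 l]
    have hD := eq_zero_of_forall_eq_smul (D := fun j => Y j - Φ (c j)) (fun j => by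
      have hY : Y (j + 1) = z (Y j) := Function.iterate_succ_apply' z j y
      rw [smul_sub, hY, hz, hc j, map_add, map_smul]
      abel) 0
    exact ⟨c 0, (sub_eq_zero.1 hD).symm⟩

/-- Let `k` be a field and `M` a `k[[u]]`-module such that for every `n ≥ 1` the
multiplication-by-`u` map `M[u^{n+1}] → M[u^n]` is surjective and `d := dim_k M[u]` is
finite.  Then the `u`-adic Tate module `T_u(M)`, regarded as a `k[[u]]`-submodule of
`∏_{n ≥ 1} M[u^n]` with the componentwise action, is a free `k[[u]]`-module of rank `d`. -/
theorem tateModule_free_of_surjective_torsion_maps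
    {k : Type*} [Field k] (M : Type*) [AddCommGroup M]
    [Module (PowerSeries k) M] [Module k M] [IsScalarTower k (PowerSeries k) M]
    (hsurj : ∀ n : ℕ, 1 ≤ n →
      ∀ m ∈ Submodule.torsionBy (PowerSeries k) M ((X : PowerSeries k) ^ n),
        ∃ m' ∈ Submodule.torsionBy (PowerSeries k) M ((X : PowerSeries k) ^ (n + 1)),
          (X : PowerSeries k) • m' = m)
    (hfd : FiniteDimensional k
      ((Submodule.torsionBy (PowerSeries k) M (X : PowerSeries k)).restrictScalars k)) :
    Nonempty (Module.Basis
      (Fin (Module.finrank k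
        ((Submodule.torsionBy (PowerSeries k) M (X : PowerSeries k)).restrictScalars k)))
      (PowerSeries k) (tateModule (PowerSeries k) (X : PowerSeries k) M)) := by
  let b := Module.finBasis k
    ((Submodule.torsionBy (PowerSeries k) M (X : PowerSeries k)).restrictScalars k)
  choose t ht using fun i => tateModule.exists_apply_zero_eq hsurj
    ((Submodule.mem_torsionBy_iff _ _).1 (b i).2)
  exact ⟨.ofEquivFun
    (LinearEquiv.ofBijective _ (tateModule.bijective_linearCombination b t ht)).symm⟩
end

section
/- Let M be a finitely generated 𝔖-module such that: (i) the localization M[1/p] = M ⊗_𝔖 𝔖[1/p] at the powers of p is a free module over 𝔖[1/p]; and (ii) M ⊗_𝔖 W(k) is a free W(k)-module, where W(k) is regarded as an 𝔖-algebra via the ring homomorphism 𝔖 → W(k) sending u to 0 (equivalently, M/uM is a free module over W(k) ≅ 𝔖/(u)). Then M is a free 𝔖-module. -/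
open PowerSeries TensorProduct

/-- For a finite module `M`, the rank of a free base change `A ⊗[R] M` is unchanged under any
further base change to a nontrivial `A`-algebra. -/
theorem finrank_baseChange_of_free (R A K M : Type*) [CommRing R] [CommRing A] [CommRing K]
    [Nontrivial K] [Algebra R A] [Algebra R K] [Algebra A K] [IsScalarTower R A K]
    [AddCommGroup M] [Module R M] [Module.Free A (A ⊗[R] M)] :
    Module.finrank K (K ⊗[R] M) = Module.finrank A (A ⊗[R] M) := by
  have := (algebraMap A K).domain_nontrivial
  rw [← (AlgebraTensorModule.cancelBaseChange R A K K M).finrank_eq, Module.finrank_baseChange]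

/-- A finite module over a local ring is generated by as many elements as the rank of a free base
change along a local homomorphism. -/
theorem exists_surjective_of_free_baseChange (R A M : Type*) [CommRing R] [IsLocalRing R]
    [CommRing A] [IsLocalRing A] [Algebra R A] [IsLocalHom (algebraMap R A)]
    [AddCommGroup M] [Module R M] [Module.Finite R M] [Module.Free A (A ⊗[R] M)] :
    ∃ f : (Fin (Module.finrank A (A ⊗[R] M)) → R) →ₗ[R] M, Function.Surjective f := by
  let κ := IsLocalRing.ResidueField R
  have hrank : Module.finrank κ (κ ⊗[R] M) = Module.finrank A (A ⊗[R] M) := by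
    rw [← finrank_baseChange_of_free R κ (IsLocalRing.ResidueField A) M,
      finrank_baseChange_of_free R A (IsLocalRing.ResidueField A) M]
  rw [← hrank]
  let b := Module.finBasis κ (κ ⊗[R] M)
  choose v hv using fun i ↦ TensorProduct.mk_surjective R M κ Ideal.Quotient.mk_surjective (b i)
  refine ⟨Fintype.linearCombination R v, ?_⟩
  rw [← LinearMap.range_eq_top, Fintype.range_linearCombination]
  exact IsLocalRing.span_eq_top_of_tmul_eq_basis v b hv

/-- A finite module over a local ring `R` is free if its base changes along an injective
homomorphism `R → S` and along a local homomorphism `R → A` are both free, provided that `S` and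
`A` map compatibly to a common nontrivial ring `K`. -/
theorem free_of_free_baseChange (R S A K M : Type*) [CommRing R] [IsLocalRing R]
    [CommRing S] [CommRing A] [IsLocalRing A] [CommRing K] [Nontrivial K]
    [Algebra R S] [Algebra R A] [Algebra R K] [Algebra S K] [Algebra A K]
    [IsScalarTower R S K] [IsScalarTower R A K] [FaithfulSMul R S]
    [IsLocalHom (algebraMap R A)] [AddCommGroup M] [Module R M] [Module.Finite R M]
    [Module.Free S (S ⊗[R] M)] [Module.Free A (A ⊗[R] M)] : Module.Free R M := by
  have := (algebraMap S K).domain_nontrivial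
  obtain ⟨f, hf⟩ := exists_surjective_of_free_baseChange R A M
  have hrank : Module.finrank S (S ⊗[R] M) =
      Module.finrank S (S ⊗[R] (Fin (Module.finrank A (A ⊗[R] M)) → R)) := by
    rw [Module.finrank_baseChange (M' := Fin _ → R), Module.finrank_fin_fun,
      ← finrank_baseChange_of_free R S K M, finrank_baseChange_of_free R A K M]
  let e := LinearEquiv.ofFinrankEq _ _ hrank
  have hinj : Function.Injective (f.baseChange S) :=
    OrzechProperty.injective_of_surjective_of_injective e.symm.toLinearMap _ e.symm.injective
      (LinearMap.lTensor_surjective S hf)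
  refine Module.Free.of_equiv (LinearEquiv.ofBijective f ⟨fun x y hxy ↦ ?_, hf⟩)
  exact Module.Flat.tensorProduct_mk_injective R (Fin _ → R) S (hinj (by simp [hxy]))

/-- Let `p` be a prime, `k` a perfect field of characteristic `p`, and `𝔖 = W(k)[[u]]`.
Let `M` be a finitely generated `𝔖`-module such that (i) the localization `M[1/p]` is a
free module over `𝔖[1/p]`, and (ii) `M ⊗_𝔖 W(k)` is a free `W(k)`-module, where `W(k)` is
an `𝔖`-algebra via the map `𝔖 → W(k)` sending `u` to `0` (the constant coefficient map).
Then `M` is a free `𝔖`-module. -/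
theorem free_of_free_localization_and_free_quotient
    (p : ℕ) [Fact p.Prime] (k : Type*) [Field k] [CharP k p] [PerfectRing k p]
    (M : Type*) [AddCommGroup M] [Module (PowerSeries (WittVector p k)) M]
    [Module.Finite (PowerSeries (WittVector p k)) M]
    (hloc : Module.Free (Localization (Submonoid.powers (p : PowerSeries (WittVector p k))))
      (LocalizedModule (Submonoid.powers (p : PowerSeries (WittVector p k))) M))
    (hquot :
      letI : Algebra (PowerSeries (WittVector p k)) (WittVector p k) :=
        (constantCoeff (R := WittVector p k)).toAlgebra
      Module.Free (WittVector p k)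
        (TensorProduct (PowerSeries (WittVector p k)) (WittVector p k) M)) :
    Module.Free (PowerSeries (WittVector p k)) M := by
  let : Algebra (PowerSeries (WittVector p k)) (WittVector p k) :=
    (constantCoeff (R := WittVector p k)).toAlgebra
  let P := Submonoid.powers (p : PowerSeries (WittVector p k))
  let K := FractionRing (WittVector p k)
  have hp : (p : WittVector p k) ≠ 0 := (WittVector.irreducible p).ne_zero
  have hunit (y : P) : IsUnit (algebraMap (PowerSeries (WittVector p k)) K y) := by
    obtain ⟨_, n, rfl⟩ := y
    have hpK : (p : K) ≠ 0 := by
      simpa using (FaithfulSMul.algebraMap_injective (WittVector p k) K).ne hp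
    simpa only [map_pow, map_natCast] using hpK.isUnit.pow n
  let : Algebra (Localization P) K := (IsLocalization.lift (M := P) hunit).toAlgebra
  have : IsScalarTower (PowerSeries (WittVector p k)) (Localization P) K :=
    IsScalarTower.of_algebraMap_eq (R := PowerSeries (WittVector p k)) (S := Localization P)
      (A := K) fun x ↦ (IsLocalization.lift_eq hunit x).symm
  have : FaithfulSMul (PowerSeries (WittVector p k)) (Localization P) := by
    rw [faithfulSMul_iff_algebraMap_injective]
    refine IsLocalization.injective (M := P) _
      (powers_le_nonZeroDivisors_of_noZeroDivisors fun h ↦ hp ?_)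
    simpa using congrArg (constantCoeff (R := WittVector p k)) h
  have : IsLocalHom (algebraMap (PowerSeries (WittVector p k)) (WittVector p k)) :=
    ⟨fun _ h ↦ isUnit_iff_constantCoeff.mpr h⟩
  have : Module.Free (Localization P) (Localization P ⊗[PowerSeries (WittVector p k)] M) :=
    .of_equiv (LocalizedModule.equivTensorProduct P M)
  have : Module.Free (WittVector p k) (WittVector p k ⊗[PowerSeries (WittVector p k)] M) := hquot
  exact free_of_free_baseChange _ (Localization P) (WittVector p k) K M
end
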